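/- Collapsing estimate for the free von-Neumann Schrödinger flow: there is a constant C > 0 such that for every Schwartz function Γ₀ on ℝ², the solution Γ(t) = e^{it(Δ_x−Δ_y)}Γ₀ of the free equation satisfies ‖ |∇_x|^{1/2} ρ_Γ ‖_{L²(ℝ_t×ℝ_x)} ≤ C ‖Γ₀‖_{L²(ℝ²)}, where ρ_Γ(t,x) := Γ(t,x,x). -/

import Mathlib

open MeasureTheory Complex SchwartzMap
open scoped ENNReal NNReal Real

noncomputable section

/-- 1D Fourier transform with the convention `f̂ ξ = ∫ e^{-iξx} f x dx`. -/
def FT1 (f : ℝ → ℂ) (ξ : ℝ) : ℂ :=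
  ∫ x : ℝ, Complex.exp (-(Complex.I) * (ξ : ℂ) * (x : ℂ)) * f x

/-- 1D inverse Fourier transform. -/
def IFT1 (g : ℝ → ℂ) (x : ℝ) : ℂ :=
  (2 * (Real.pi : ℂ))⁻¹ * ∫ ξ : ℝ, Complex.exp (Complex.I * (ξ : ℂ) * (x : ℂ)) * g ξ

/-- 2D Fourier transform (curried kernels). -/
def FT2 (f : ℝ → ℝ → ℂ) (ξ η : ℝ) : ℂ :=
  ∫ x : ℝ, ∫ y : ℝ, Complex.exp (-(Complex.I) * ((ξ : ℂ) * x + (η : ℂ) * y)) * f x y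

/-- 2D inverse Fourier transform. -/
def IFT2 (g : ℝ → ℝ → ℂ) (x y : ℝ) : ℂ :=
  ((2 * (Real.pi : ℂ)) ^ 2)⁻¹ *
    ∫ ξ : ℝ, ∫ η : ℝ, Complex.exp (Complex.I * ((ξ : ℂ) * x + (η : ℂ) * y)) * g ξ η

/-- Free propagator `e^{it(Δ_x − Δ_y)}`, Fourier multiplier `e^{it(η²−ξ²)}`. -/
def freeGamma (Γ₀ : ℝ → ℝ → ℂ) (t x y : ℝ) : ℂ :=
  IFT2 (fun ξ η => Complex.exp (Complex.I * (t : ℂ) * ((η : ℂ) ^ 2 - (ξ : ℂ) ^ 2)) * FT2 Γ₀ ξ η) x y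

/-- Free propagator `e^{it(Δ_x + Δ_y)}`, Fourier multiplier `e^{−it(ξ²+η²)}`. -/
def freeLambda (Λ₀ : ℝ → ℝ → ℂ) (t x y : ℝ) : ℂ :=
  IFT2 (fun ξ η => Complex.exp (-(Complex.I) * (t : ℂ) * ((ξ : ℂ) ^ 2 + (η : ℂ) ^ 2)) * FT2 Λ₀ ξ η) x y

/-- `|∇_x|^s`, Fourier multiplier `|ξ|^s` in one variable. -/
def absDx (s : ℝ) (f : ℝ → ℂ) (x : ℝ) : ℂ :=
  IFT1 (fun ξ => ((|ξ| ^ s : ℝ) : ℂ) * FT1 f ξ) x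

/-- `|∇_{x,y}|^s`, Fourier multiplier `(ξ²+η²)^{s/2}` on `ℝ²`. -/
def absDxy (s : ℝ) (f : ℝ → ℝ → ℂ) (x y : ℝ) : ℂ :=
  IFT2 (fun ξ η => (((ξ ^ 2 + η ^ 2) ^ (s / 2) : ℝ) : ℂ) * FT2 f ξ η) x y

/-- `|∇_{x+y}|^s`, Fourier multiplier `(|ξ+η|/2)^s` on `ℝ²`. -/
def absDxpy (s : ℝ) (f : ℝ → ℝ → ℂ) (x y : ℝ) : ℂ :=
  IFT2 (fun ξ η => (((|ξ + η| / 2) ^ s : ℝ) : ℂ) * FT2 f ξ η) x y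

/-- `⟨∇_x⟩^s`, Fourier multiplier `(1+ξ²)^{s/2}` in one variable. -/
def japDx (s : ℝ) (f : ℝ → ℂ) (x : ℝ) : ℂ :=
  IFT1 (fun ξ => (((1 + ξ ^ 2) ^ (s / 2) : ℝ) : ℂ) * FT1 f ξ) x

/-- `⟨∇_{x,y}⟩^s`, Fourier multiplier `(1+ξ²+η²)^{s/2}` on `ℝ²`. -/
def japDxy (s : ℝ) (f : ℝ → ℝ → ℂ) (x y : ℝ) : ℂ :=
  IFT2 (fun ξ η => (((1 + ξ ^ 2 + η ^ 2) ^ (s / 2) : ℝ) : ℂ) * FT2 f ξ η) x y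

/-- `L²` norm of a kernel on `ℝ²`. -/
def L2K (f : ℝ → ℝ → ℂ) : ℝ≥0∞ :=
  eLpNorm (fun p : ℝ × ℝ => f p.1 p.2) 2 volume

/-- `L²` norm on `ℝ`. -/
def L2F (f : ℝ → ℂ) : ℝ≥0∞ := eLpNorm f 2 volume

/-- Mixed norm `L^q(μ(dt)) L^r(dx)` for a function of `(t,x)`. -/
def MixedN2 (μ : Measure ℝ) (q r : ℝ≥0∞) (u : ℝ → ℝ → ℂ) : ℝ≥0∞ :=
  eLpNorm (fun t => (eLpNorm (u t) r volume).toReal) q μ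

/-- Mixed norm `L^q(μ(dt)) L^r(dx) L^s(dy)` for a function of `(t,x,y)`. -/
def MixedN3 (μ : Measure ℝ) (q r s : ℝ≥0∞) (u : ℝ → ℝ → ℝ → ℂ) : ℝ≥0∞ :=
  eLpNorm (fun t => (eLpNorm (fun x => (eLpNorm (u t x) s volume).toReal) r volume).toReal) q μ

/-- Spacetime Fourier transform on `ℝ_t × ℝ_x`. -/
def FTtx (u : ℝ → ℝ → ℂ) (τ ξ : ℝ) : ℂ :=
  ∫ t : ℝ, ∫ x : ℝ, Complex.exp (-(Complex.I) * ((τ : ℂ) * t + (ξ : ℂ) * x)) * u t x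

/-- Spacetime Fourier transform on `ℝ_t × ℝ²`. -/
def FTtxy (u : ℝ → ℝ → ℝ → ℂ) (τ ξ η : ℝ) : ℂ :=
  ∫ t : ℝ, ∫ x : ℝ, ∫ y : ℝ,
    Complex.exp (-(Complex.I) * ((τ : ℂ) * t + (ξ : ℂ) * x + (η : ℂ) * y)) * u t x y

/-- Bourgain space norm `X^b` associated to `𝐒 = (1/i)∂_t − Δ_x − Δ_y`. -/
def XbNorm (b : ℝ) (u : ℝ → ℝ → ℝ → ℂ) : ℝ≥0∞ :=
  eLpNorm (fun p : ℝ × ℝ × ℝ =>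
    (((1 + |p.1 + p.2.1 ^ 2 + p.2.2 ^ 2|) ^ b : ℝ) : ℂ) * FTtxy u p.1 p.2.1 p.2.2) 2 volume

/-- Duhamel solution of `𝐒_± Γ = F` with data `Γ₀`. -/
def duhamelGamma (Γ₀ : ℝ → ℝ → ℂ) (F : ℝ → ℝ → ℝ → ℂ) (t x y : ℝ) : ℂ :=
  freeGamma Γ₀ t x y + Complex.I * ∫ s in (0:ℝ)..t, freeGamma (F s) (t - s) x y

/-- Duhamel solution of `𝐒 Λ = F` with data `Λ₀`. -/
def duhamelLambda (Λ₀ : ℝ → ℝ → ℂ) (F : ℝ → ℝ → ℝ → ℂ) (t x y : ℝ) : ℂ :=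
  freeLambda Λ₀ t x y + Complex.I * ∫ s in (0:ℝ)..t, freeLambda (F s) (t - s) x y


open FourierTransform

theorem eLpNorm_two_sq {α E : Type*} [MeasurableSpace α] [NormedAddCommGroup E] (f : α → E)
    (μ : Measure α) : eLpNorm f 2 μ ^ 2 = ∫⁻ x, ‖f x‖ₑ ^ 2 ∂μ := by
  have h := eLpNorm_nnreal_pow_eq_lintegral (f := f) (μ := μ) (p := 2) two_ne_zero
  simpa using h

theorem lintegral_comp_mul_left_real (f : ℝ → ℝ≥0∞) {a : ℝ} (ha : a ≠ 0) :
    ∫⁻ x, f (a * x) = ENNReal.ofReal |a⁻¹| * ∫⁻ x, f x := by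
  have h := lintegral_map_equiv (μ := (volume : Measure ℝ)) f
    (Homeomorph.mulLeft₀ a ha).toMeasurableEquiv
  have h2 : Measure.map (Homeomorph.mulLeft₀ a ha).toMeasurableEquiv volume
    = ENNReal.ofReal |a⁻¹| • (volume : Measure ℝ) := Real.map_volume_mul_left ha
  rw [h2, lintegral_smul_measure] at h
  simpa using h.symm

theorem fourier_toLp_ae_eq {f : ℝ → ℂ} (hf : Integrable f) (hf2 : MemLp f 2 volume) :
    (𝓕 (hf2.toLp f) : Lp ℂ 2 (volume : Measure ℝ)) =ᵐ[volume] 𝓕 f := by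
  have hcont : Continuous (𝓕 f) :=
    VectorFourier.fourierIntegral_continuous (L := innerₗ ℝ) Real.continuous_fourierChar
      (by exact continuous_inner) hf
  refine ae_eq_of_integral_contDiff_smul_eq
    ((Lp.memLp _).locallyIntegrable one_le_two) hcont.locallyIntegrable ?_
  intro g hg hgc
  have hgc' : HasCompactSupport (fun x => (g x : ℂ)) := hgc.comp_left (g := ((↑) : ℝ → ℂ)) (by simp)
  have hg' : ContDiff ℝ (⊤ : ℕ∞) (fun x => (g x : ℂ)) := Complex.ofRealCLM.contDiff.comp hg
  let φ : 𝓢(ℝ, ℂ) := hgc'.toSchwartzMap hg'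
  have hφ : ∀ x, φ x = g x := fun x => rfl
  have key := congrArg (fun T => T φ) (Lp.fourier_toTemperedDistribution_eq (hf2.toLp f))
  simp only [TemperedDistribution.fourier_apply, Lp.toTemperedDistribution_apply] at key
  have h1 : ∫ x, g x • (𝓕 (hf2.toLp f) : Lp ℂ 2 (volume : Measure ℝ)) x
      = ∫ x, φ x • (𝓕 (hf2.toLp f) : Lp ℂ 2 (volume : Measure ℝ)) x := by
    simp [hφ]
  rw [h1, ← key]
  have h2 : ∫ x, (𝓕 φ) x • (hf2.toLp f) x = ∫ x, (𝓕 φ) x • f x := by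
    refine integral_congr_ae ?_
    filter_upwards [hf2.coeFn_toLp] with x hx
    rw [hx]
  rw [h2, SchwartzMap.fourier_coe]
  have h3 := VectorFourier.integral_fourierIntegral_smul_eq_flip (L := innerₗ ℝ)
    (μ := volume) (ν := volume) (f := φ) (g := f)
    Real.continuous_fourierChar (by exact continuous_inner) φ.integrable hf
  rw [flip_innerₗ] at h3
  exact h3

theorem lintegral_fourier_sq_le (f : ℝ → ℂ) : ∫⁻ x, ‖𝓕 f x‖ₑ ^ 2 ≤ ∫⁻ x, ‖f x‖ₑ ^ 2 := by
  by_cases hf : Integrable f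
  · by_cases hf2 : MemLp f 2 volume
    · rw [← eLpNorm_two_sq, ← eLpNorm_two_sq,
        ← eLpNorm_congr_ae (fourier_toLp_ae_eq hf hf2), ← Lp.enorm_def,
        enorm_eq_iff_norm_eq.2 (Lp.norm_fourier_eq (hf2.toLp f)), Lp.enorm_def,
        eLpNorm_congr_ae hf2.coeFn_toLp]
    · rw [← eLpNorm_two_sq f]
      have : eLpNorm f 2 volume = ∞ := by
        by_contra h
        exact hf2 ⟨hf.1, lt_top_iff_ne_top.2 h⟩
      simp [this]
  · have : ∀ x, 𝓕 f x = 0 := fun x => by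
      rw [Real.fourier_eq]
      exact integral_undef (fun h => hf ((Real.fourierIntegral_convergent_iff x).1 h))
    simp [this]

theorem FT1_eq_fourier (f : ℝ → ℂ) (ξ : ℝ) : FT1 f ξ = 𝓕 f ((2 * π)⁻¹ * ξ) := by
  rw [FT1, Real.fourier_real_eq_integral_exp_smul]
  refine integral_congr_ae (.of_forall fun x => ?_)
  simp only [smul_eq_mul]
  congr 2
  push_cast
  field_simp

theorem IFT1_eq_FT1 (g : ℝ → ℂ) (x : ℝ) : IFT1 g x = (2 * (π : ℂ))⁻¹ * FT1 g (-x) := by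
  rw [IFT1, FT1]
  congr 1
  refine integral_congr_ae (.of_forall fun x => ?_)
  simp only [ofReal_neg]
  congr 2
  ring

theorem lintegral_FT1_sq_le (f : ℝ → ℂ) :
    ∫⁻ ξ, ‖FT1 f ξ‖ₑ ^ 2 ≤ ENNReal.ofReal (2 * π) * ∫⁻ x, ‖f x‖ₑ ^ 2 := by
  have hpi : (2 * π)⁻¹ ≠ 0 := by positivity
  simp_rw [FT1_eq_fourier]
  rw [lintegral_comp_mul_left_real (fun x => ‖𝓕 f x‖ₑ ^ 2) hpi, inv_inv,
    abs_of_pos Real.two_pi_pos]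
  exact mul_le_mul_right (lintegral_fourier_sq_le f) _

theorem lintegral_IFT1_sq_le (g : ℝ → ℂ) :
    ∫⁻ x, ‖IFT1 g x‖ₑ ^ 2 ≤ ENNReal.ofReal (2 * π)⁻¹ * ∫⁻ ξ, ‖g ξ‖ₑ ^ 2 := by
  have hc : ‖(2 * (π : ℂ))⁻¹‖ₑ = ENNReal.ofReal (2 * π)⁻¹ := by
    rw [← ofReal_norm]
    simp [abs_of_pos Real.pi_pos]
  simp_rw [IFT1_eq_FT1, enorm_mul, mul_pow, hc]
  rw [lintegral_const_mul' _ _ (by simp), lintegral_neg_eq_self (fun x => ‖FT1 g x‖ₑ ^ 2)]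
  calc _ ≤ ENNReal.ofReal (2 * π)⁻¹ ^ 2 * (ENNReal.ofReal (2 * π) * ∫⁻ x, ‖g x‖ₑ ^ 2) := by
        exact mul_le_mul_right (lintegral_FT1_sq_le g) _
    _ = _ := by
        rw [← mul_assoc, ← ENNReal.ofReal_pow (by positivity), ← ENNReal.ofReal_mul (by positivity)]
        congr 2
        field_simp

theorem exists_schwartzMap_eq_FT2 (Γ₀ : 𝓢(ℝ × ℝ, ℂ)) :
    ∃ S : 𝓢(ℝ × ℝ, ℂ), (∀ ξ η, S (ξ, η) = FT2 (fun a b => Γ₀ (a, b)) ξ η) ∧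
      ∫⁻ p, ‖S p‖ₑ ^ 2 = ENNReal.ofReal ((2 * π) ^ 2) * ∫⁻ p, ‖Γ₀ p‖ₑ ^ 2 := by
  let e : EuclideanSpace ℝ (Fin 2) ≃L[ℝ] ℝ × ℝ :=
    (PiLp.continuousLinearEquiv 2 ℝ (fun _ : Fin 2 => ℝ)).trans
      (ContinuousLinearEquiv.finTwoArrow ℝ ℝ)
  have he : ∀ v, e v = (v 0, v 1) := fun v => rfl
  have hemp : MeasurePreserving e volume volume :=
    (volume_preserving_finTwoArrow ℝ).comp (PiLp.volume_preserving_ofLp (Fin 2))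
  have heemb : MeasurableEmbedding e := e.toHomeomorph.measurableEmbedding
  have hpi : (2 * π)⁻¹ ≠ 0 := by positivity
  let d : (ℝ × ℝ) ≃L[ℝ] ℝ × ℝ := ContinuousLinearEquiv.smulLeft (Units.mk0 (2 * π)⁻¹ hpi)
  have hd : ∀ p, d p = (2 * π)⁻¹ • p := fun p => rfl
  let Γ₁ : 𝓢(EuclideanSpace ℝ (Fin 2), ℂ) := compCLMOfContinuousLinearEquiv ℂ e Γ₀
  have hΓ₁ : ∀ v, Γ₁ v = Γ₀ (e v) := fun v => rfl
  refine ⟨compCLMOfContinuousLinearEquiv ℂ (d.trans e.symm) (𝓕 Γ₁), fun ξ η => ?_, ?_⟩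
  · have h1 : e (e.symm (d (ξ, η))) = ((2 * π)⁻¹ * ξ, (2 * π)⁻¹ * η) := by
      simp [hd]
    rw [he, Prod.mk.injEq] at h1
    have hint : Integrable (fun p : ℝ × ℝ =>
        Complex.exp (-(Complex.I) * ((ξ : ℂ) * p.1 + (η : ℂ) * p.2)) * Γ₀ p) := by
      refine Γ₀.integrable.bdd_mul (c := 1) (by fun_prop) (.of_forall fun p => ?_)
      rw [Complex.norm_exp]
      simp
    change (𝓕 Γ₁) (e.symm (d (ξ, η))) = _
    rw [SchwartzMap.fourier_coe, Real.fourier_eq', FT2,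
      ← integral_prod (f := fun p : ℝ × ℝ =>
        Complex.exp (-(Complex.I) * ((ξ : ℂ) * p.1 + (η : ℂ) * p.2)) * Γ₀ p) hint,
      ← Measure.volume_eq_prod, ← hemp.integral_comp heemb]
    refine integral_congr_ae (.of_forall fun v => ?_)
    simp only [smul_eq_mul, hΓ₁, he, PiLp.inner_apply, Fin.sum_univ_two, h1]
    congr 2
    simp
    field_simp
  · change ∫⁻ p, ‖(𝓕 Γ₁) (e.symm (d p))‖ₑ ^ 2 = _
    have h1 := lintegral_map_equiv (μ := (volume : Measure (ℝ × ℝ)))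
      (fun p => ‖(𝓕 Γ₁) (e.symm p)‖ₑ ^ 2) d.toHomeomorph.toMeasurableEquiv
    have h2 : Measure.map d.toHomeomorph.toMeasurableEquiv volume
        = ENNReal.ofReal ((2 * π) ^ 2) • (volume : Measure (ℝ × ℝ)) := by
      have := Measure.map_addHaar_smul (volume : Measure (ℝ × ℝ)) hpi
      simp only [Module.finrank_prod, Module.finrank_self] at this
      rw [inv_pow, inv_inv, abs_of_nonneg (by positivity)] at this
      exact this
    rw [h2, lintegral_smul_measure] at h1
    refine h1.symm.trans ?_
    rw [smul_eq_mul, ← hemp.lintegral_comp_emb heemb, ← hemp.lintegral_comp_emb heemb]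
    simp only [ContinuousLinearEquiv.symm_apply_apply, ← hΓ₁]
    congr 1
    rw [← eLpNorm_two_sq, ← eLpNorm_two_sq]
    have h3 := SchwartzMap.norm_fourier_toL2_eq Γ₁
    rw [← enorm_eq_iff_norm_eq, Lp.enorm_def, Lp.enorm_def,
      eLpNorm_congr_ae (SchwartzMap.coeFn_toLp _ _ _),
      eLpNorm_congr_ae (SchwartzMap.coeFn_toLp _ _ _)] at h3
    rw [h3]

/-- For the Fourier transform `S` of a kernel, the frequency-`ζ` component of the diagonal
restriction of its free evolution at time `t`, up to the factor `(2π)⁻¹`. -/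
def diagonalFT (S : 𝓢(ℝ × ℝ, ℂ)) (t ζ : ℝ) : ℂ :=
  ∫ ξ : ℝ, Complex.exp (Complex.I * (t : ℂ) * ((ζ : ℂ) * (ζ - 2 * ξ))) * S (ξ, ζ - ξ)

theorem norm_exp_phase (t ζ ξ : ℝ) :
    ‖Complex.exp (Complex.I * (t : ℂ) * ((ζ : ℂ) * (ζ - 2 * ξ)))‖ = 1 := by
  rw [Complex.norm_exp]
  simp

theorem exists_norm_le_inv_one_add_sq (S : 𝓢(ℝ × ℝ, ℂ)) :
    ∃ K : ℝ, ∀ ξ η : ℝ, ‖S (ξ, η)‖ ≤ K * (1 + ξ ^ 2)⁻¹ := by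
  obtain ⟨K₀, -, h₀⟩ := S.decay 0 0
  obtain ⟨K₂, -, h₂⟩ := S.decay 2 0
  refine ⟨K₀ + K₂, fun ξ η => ?_⟩
  have h0 := h₀ (ξ, η)
  have h2 := h₂ (ξ, η)
  simp only [norm_iteratedFDeriv_zero, pow_zero, one_mul] at h0 h2
  rw [← div_eq_mul_inv, le_div_iff₀ (by positivity)]
  have h3 : ξ ^ 2 ≤ ‖(ξ, η)‖ ^ 2 := by
    rw [← sq_abs, ← Real.norm_eq_abs]
    gcongr
    exact norm_fst_le (ξ, η)
  nlinarith [mul_le_mul_of_nonneg_right h3 (norm_nonneg (S (ξ, η)))]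

theorem continuous_diagonalFT (S : 𝓢(ℝ × ℝ, ℂ)) :
    Continuous (fun p : ℝ × ℝ => diagonalFT S p.1 p.2) := by
  obtain ⟨K, hK⟩ := exists_norm_le_inv_one_add_sq S
  refine continuous_of_dominated (bound := fun ξ => K * (1 + ξ ^ 2)⁻¹) (fun p => ?_)
    (fun p => .of_forall fun ξ => ?_) (integrable_inv_one_add_sq.const_mul K)
    (.of_forall fun ξ => ?_)
  · have : Continuous (fun ξ : ℝ => S (ξ, p.2 - ξ)) := S.continuous.comp (by fun_prop)
    exact Continuous.aestronglyMeasurable (by fun_prop)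
  · rw [norm_mul, norm_exp_phase, one_mul]
    exact hK _ _
  · have : Continuous (fun p : ℝ × ℝ => S (ξ, p.2 - ξ)) := S.continuous.comp (by fun_prop)
    fun_prop

theorem measurePreserving_shear :
    MeasurePreserving (fun p : ℝ × ℝ => (p.1, p.2 - p.1)) volume volume := by
  have h := measurePreserving_prod_neg_add (volume : Measure ℝ) (volume : Measure ℝ)
  simpa [neg_add_eq_sub, Measure.volume_eq_prod] using h

theorem integrable_diagonalFT_integrand (S : 𝓢(ℝ × ℝ, ℂ)) (t x : ℝ) :
    Integrable (fun p : ℝ × ℝ => Complex.exp (Complex.I * (p.2 : ℂ) * (x : ℂ)) *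
      (Complex.exp (Complex.I * (t : ℂ) * ((p.2 : ℂ) * (p.2 - 2 * p.1))) * S (p.1, p.2 - p.1)))
      (volume.prod volume) := by
  have hS := measurePreserving_shear.integrable_comp_of_integrable S.integrable
  rw [← Measure.volume_eq_prod]
  refine Integrable.bdd_mul (c := 1) (Integrable.bdd_mul (c := 1) hS (by fun_prop)
    (.of_forall fun p => (norm_exp_phase _ _ _).le)) (by fun_prop) (.of_forall fun p => ?_)
  rw [Complex.norm_exp]
  simp

theorem integrable_diagonalFT (S : 𝓢(ℝ × ℝ, ℂ)) (t : ℝ) : Integrable (diagonalFT S t) := by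
  have h := (integrable_diagonalFT_integrand S t 0).swap.integral_prod_left
  simp only [Function.comp_def, Prod.fst_swap, Prod.snd_swap, ofReal_zero, mul_zero, exp_zero,
    one_mul] at h
  exact h

theorem freeGamma_diag_eq (Γ₀ : ℝ → ℝ → ℂ) (S : 𝓢(ℝ × ℝ, ℂ))
    (hS : ∀ ξ η, S (ξ, η) = FT2 Γ₀ ξ η) (t x : ℝ) :
    freeGamma Γ₀ t x x = (2 * (π : ℂ))⁻¹ * IFT1 (diagonalFT S t) x := by
  have hswap := integral_integral_swap
    (f := fun ξ ζ : ℝ => Complex.exp (Complex.I * (ζ : ℂ) * (x : ℂ)) *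
      (Complex.exp (Complex.I * (t : ℂ) * ((ζ : ℂ) * (ζ - 2 * ξ))) * S (ξ, ζ - ξ)))
    (integrable_diagonalFT_integrand S t x)
  simp only [integral_const_mul] at hswap
  rw [freeGamma, IFT2, IFT1, ← mul_assoc, sq, mul_inv]
  congr 1
  simp only [diagonalFT]
  rw [← hswap]
  refine integral_congr_ae (.of_forall fun ξ => ?_)
  dsimp only
  rw [← integral_sub_right_eq_self _ ξ]
  refine integral_congr_ae (.of_forall fun ζ => ?_)
  simp only [← hS, ← mul_assoc, ← Complex.exp_add]
  congr 2
  push_cast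
  ring

theorem FT1_IFT1 {h : ℝ → ℂ} (hc : Continuous h) (hi : Integrable h) (hi' : Integrable (IFT1 h))
    (ξ : ℝ) : FT1 (IFT1 h) ξ = h ξ := by
  have hpi : (2 * (π : ℂ)) ≠ 0 := by simp [Real.pi_ne_zero]
  have hI : ∀ x, 𝓕⁻ h x = 2 * (π : ℂ) * IFT1 h (2 * π * x) := fun x => by
    rw [IFT1_eq_FT1, FT1_eq_fourier, ← mul_assoc, mul_inv_cancel₀ hpi, one_mul,
      Real.fourierInv_eq_fourier_neg]
    field_simp
  have hi2 : Integrable (𝓕⁻ h) := by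
    rw [funext hI]
    exact (hi'.comp_mul_left' Real.two_pi_pos.ne').const_mul _
  have h1 : Integrable (𝓕 h) := by
    have := hi2.comp_neg
    simpa [Real.fourierInv_eq_fourier_neg] using this
  calc FT1 (IFT1 h) ξ
      = 𝓕 (𝓕⁻ h) ξ := by
        have hscale := Measure.integral_comp_mul_left
          (fun x : ℝ => Complex.exp (-(Complex.I) * (ξ : ℂ) * (x : ℂ)) * IFT1 h x) (2 * π)
        rw [abs_of_pos (by positivity), eq_inv_smul_iff₀ Real.two_pi_pos.ne',
          ← integral_smul] at hscale
        rw [FT1, ← hscale, Real.fourier_real_eq_integral_exp_smul]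
        refine integral_congr_ae (.of_forall fun x => ?_)
        simp only [hI, smul_eq_mul, Complex.real_smul]
        push_cast
        rw [mul_left_comm]
        congr 2
        ring
    _ = h ξ := by rw [hc.fourier_fourierInv_eq hi h1]

theorem enorm_FT1_freeGamma_diag_le (Γ₀ : ℝ → ℝ → ℂ) (S : 𝓢(ℝ × ℝ, ℂ))
    (hS : ∀ ξ η, S (ξ, η) = FT2 Γ₀ ξ η) (t ζ : ℝ) :
    ‖FT1 (fun a => freeGamma Γ₀ t a a) ζ‖ₑ ≤
      ENNReal.ofReal (2 * π)⁻¹ * ‖diagonalFT S t ζ‖ₑ := by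
  have hc : ‖(2 * (π : ℂ))⁻¹‖ₑ = ENNReal.ofReal (2 * π)⁻¹ := by
    rw [← ofReal_norm]
    simp [abs_of_pos Real.pi_pos]
  have h1 : FT1 (fun a => freeGamma Γ₀ t a a) ζ
      = (2 * (π : ℂ))⁻¹ * FT1 (IFT1 (diagonalFT S t)) ζ := by
    rw [FT1, FT1, ← integral_const_mul]
    refine integral_congr_ae (.of_forall fun x => ?_)
    simp only [freeGamma_diag_eq Γ₀ S hS]
    ring
  rw [h1, enorm_mul, hc]
  by_cases hi : Integrable (IFT1 (diagonalFT S t))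
  · have hcont : Continuous (diagonalFT S t) :=
      (continuous_diagonalFT S).comp (by fun_prop : Continuous fun ζ : ℝ => (t, ζ))
    rw [FT1_IFT1 hcont (integrable_diagonalFT S t) hi]
  · rw [FT1_eq_fourier, Real.fourier_eq, integral_undef]
    · simp
    · exact fun h => hi ((Real.fourierIntegral_convergent_iff _).1 h)

theorem enorm_diagonalFT (S : 𝓢(ℝ × ℝ, ℂ)) (t ζ : ℝ) :
    ‖diagonalFT S t ζ‖ₑ = ‖FT1 (fun ξ => S (ξ, ζ - ξ)) (2 * ζ * t)‖ₑ := by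
  have h : diagonalFT S t ζ = Complex.exp (Complex.I * (t : ℂ) * ((ζ : ℂ) * (ζ - 2 * (0 : ℝ)))) *
      FT1 (fun ξ => S (ξ, ζ - ξ)) (2 * ζ * t) := by
    rw [diagonalFT, FT1, ← integral_const_mul]
    refine integral_congr_ae (.of_forall fun ξ => ?_)
    simp only [← mul_assoc, ← Complex.exp_add]
    congr 2
    push_cast
    ring
  rw [h, enorm_mul, ← ofReal_norm (Complex.exp _), norm_exp_phase, ENNReal.ofReal_one, one_mul]

theorem lintegral_diagonalFT_sq_le (S : 𝓢(ℝ × ℝ, ℂ)) (ζ : ℝ) :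
    ∫⁻ t, ENNReal.ofReal |ζ| * ‖diagonalFT S t ζ‖ₑ ^ 2 ≤
      ENNReal.ofReal π * ∫⁻ ξ, ‖S (ξ, ζ - ξ)‖ₑ ^ 2 := by
  rcases eq_or_ne ζ 0 with rfl | hζ
  · simp
  · simp_rw [enorm_diagonalFT]
    rw [lintegral_const_mul' _ _ (by simp), lintegral_comp_mul_left_real
      (fun s => ‖FT1 (fun ξ => S (ξ, ζ - ξ)) s‖ₑ ^ 2) (by simpa using hζ : 2 * ζ ≠ 0)]
    calc _ ≤ ENNReal.ofReal |ζ| * (ENNReal.ofReal |(2 * ζ)⁻¹| *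
          (ENNReal.ofReal (2 * π) * ∫⁻ ξ, ‖S (ξ, ζ - ξ)‖ₑ ^ 2)) :=
        mul_le_mul_right (mul_le_mul_right (lintegral_FT1_sq_le _) _) _
      _ = _ := by
        rw [← mul_assoc, ← mul_assoc, ← ENNReal.ofReal_mul (by positivity),
          ← ENNReal.ofReal_mul (by positivity)]
        congr 2
        rw [abs_inv, abs_mul, abs_two]
        field_simp

theorem lintegral_lintegral_diagonalFT_sq_le (S : 𝓢(ℝ × ℝ, ℂ)) :
    ∫⁻ t, ∫⁻ ζ, ENNReal.ofReal |ζ| * ‖diagonalFT S t ζ‖ₑ ^ 2 ≤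
      ENNReal.ofReal π * ∫⁻ p, ‖S p‖ₑ ^ 2 := by
  have hm : Measurable (fun p : ℝ × ℝ => ENNReal.ofReal |p.2| * ‖diagonalFT S p.1 p.2‖ₑ ^ 2) := by
    have := (continuous_diagonalFT S).measurable
    fun_prop
  have hmS : Measurable (fun p : ℝ × ℝ => ‖S (p.1, p.2 - p.1)‖ₑ ^ 2) := by
    have : Measurable (fun p : ℝ × ℝ => S (p.1, p.2 - p.1)) :=
      (S.continuous.comp (by fun_prop)).measurable
    exact this.enorm.pow_const 2
  rw [lintegral_lintegral_swap hm.aemeasurable]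
  calc _ ≤ ∫⁻ ζ, ENNReal.ofReal π * ∫⁻ ξ, ‖S (ξ, ζ - ξ)‖ₑ ^ 2 :=
        lintegral_mono fun ζ => lintegral_diagonalFT_sq_le S ζ
    _ = ENNReal.ofReal π * ∫⁻ ξ, ∫⁻ ζ, ‖S (ξ, ζ - ξ)‖ₑ ^ 2 := by
        rw [lintegral_const_mul' _ _ (by simp),
          lintegral_lintegral_swap (f := fun ξ ζ => ‖S (ξ, ζ - ξ)‖ₑ ^ 2) hmS.aemeasurable]
    _ = _ := by
        rw [← measurePreserving_shear.lintegral_comp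
          (f := fun p => ‖S p‖ₑ ^ 2) (by have := S.continuous.measurable; fun_prop),
          Measure.volume_eq_prod, lintegral_prod _ hmS.aemeasurable]

/-- Collapsing estimate for the free von-Neumann Schrödinger flow. -/
theorem collapsing_estimate_free_vonNeumann :
    ∃ C : ℝ, 0 < C ∧ ∀ Γ₀ : 𝓢(ℝ × ℝ, ℂ),
      MixedN2 volume 2 2
          (fun t x => absDx (1/2) (fun a => freeGamma (fun a b => Γ₀ (a, b)) t a a) x)
        ≤ ENNReal.ofReal C * L2K (fun a b => Γ₀ (a, b)) := by
  refine ⟨1, one_pos, fun Γ₀ => ?_⟩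
  obtain ⟨S, hS, hS2⟩ := exists_schwartzMap_eq_FT2 Γ₀
  have hmult : ∀ t, ∫⁻ ζ, ‖((|ζ| ^ (1 / 2 : ℝ) : ℝ) : ℂ) *
      FT1 (fun a => freeGamma (fun a b => Γ₀ (a, b)) t a a) ζ‖ₑ ^ 2 ≤
      ENNReal.ofReal (2 * π)⁻¹ ^ 2 * ∫⁻ ζ, ENNReal.ofReal |ζ| * ‖diagonalFT S t ζ‖ₑ ^ 2 := by
    intro t
    rw [← lintegral_const_mul' _ _ (by simp)]
    refine lintegral_mono fun ζ => ?_
    have h1 : ‖((|ζ| ^ (1 / 2 : ℝ) : ℝ) : ℂ)‖ₑ ^ 2 = ENNReal.ofReal |ζ| := by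
      rw [← ofReal_norm, Complex.norm_real, Real.norm_of_nonneg (by positivity),
        ← ENNReal.ofReal_pow (by positivity), ← Real.rpow_mul_natCast (abs_nonneg _)]
      norm_num
    calc _ = ENNReal.ofReal |ζ| *
          ‖FT1 (fun a => freeGamma (fun a b => Γ₀ (a, b)) t a a) ζ‖ₑ ^ 2 := by
          rw [enorm_mul, mul_pow, h1]
      _ ≤ ENNReal.ofReal |ζ| * (ENNReal.ofReal (2 * π)⁻¹ * ‖diagonalFT S t ζ‖ₑ) ^ 2 := by
          gcongr
          exact enorm_FT1_freeGamma_diag_le _ S hS t ζ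
      _ = _ := by ring
  rw [ENNReal.ofReal_one, one_mul, ← ENNReal.pow_le_pow_left_iff two_ne_zero, MixedN2, L2K,
    eLpNorm_two_sq, eLpNorm_two_sq]
  calc ∫⁻ t, ‖(eLpNorm (fun x => absDx (1/2)
          (fun a => freeGamma (fun a b => Γ₀ (a, b)) t a a) x) 2 volume).toReal‖ₑ ^ 2
      ≤ ∫⁻ t, ENNReal.ofReal (2 * π)⁻¹ * (ENNReal.ofReal (2 * π)⁻¹ ^ 2 *
          ∫⁻ ζ, ENNReal.ofReal |ζ| * ‖diagonalFT S t ζ‖ₑ ^ 2) := by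
        refine lintegral_mono fun t => ?_
        refine le_trans ?_ (mul_le_mul_right (hmult t) _)
        refine le_trans ?_ (lintegral_IFT1_sq_le _)
        rw [← eLpNorm_two_sq]
        gcongr
        rw [Real.enorm_of_nonneg ENNReal.toReal_nonneg]
        exact ENNReal.ofReal_toReal_le
    _ ≤ ENNReal.ofReal (2 * π)⁻¹ * (ENNReal.ofReal (2 * π)⁻¹ ^ 2 *
          (ENNReal.ofReal π * (ENNReal.ofReal ((2 * π) ^ 2) * ∫⁻ p, ‖Γ₀ p‖ₑ ^ 2))) := by
        rw [lintegral_const_mul' _ _ (by simp), lintegral_const_mul' _ _ (by simp), ← hS2]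
        exact mul_le_mul_right (mul_le_mul_right (lintegral_lintegral_diagonalFT_sq_le S) _) _
    _ = ENNReal.ofReal (1 / 2) * ∫⁻ p, ‖Γ₀ p‖ₑ ^ 2 := by
        simp only [← mul_assoc]
        rw [← ENNReal.ofReal_pow (by positivity), ← ENNReal.ofReal_mul (by positivity),
          ← ENNReal.ofReal_mul (by positivity), ← ENNReal.ofReal_mul (by positivity)]
        congr 2
        field_simp
    _ ≤ 1 * ∫⁻ p, ‖Γ₀ p‖ₑ ^ 2 := by
        gcongr
        rw [← ENNReal.ofReal_one]
        exact ENNReal.ofReal_le_ofReal (by norm_num)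
    _ = _ := by simp

end
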